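/- Let T(L) be a generic Gelfand–Tsetlin tableau of height n, i.e. l_{ki} − l_{kj} ∉ ℤ + ½·1(q) for all 1 ≤ i < j ≤ k ≤ n (equivalently, T(L) is a ∅-realization). Then the Gelfand–Tsetlin operators e_k, f_k (1 ≤ k ≤ n−1) and q^{ε_k} (1 ≤ k ≤ n) on V_∅(T(L)) satisfy all the defining relations of U_q(gl_n): the q^{ε_k} are invertible and mutually commute; q^{ε_k} e_l (q^{ε_k})^{−1} = q^{δ_{kl} − δ_{k,l+1}} e_l and q^{ε_k} f_l (q^{ε_k})^{−1} = q^{−δ_{kl} + δ_{k,l+1}} f_l; e_i f_j − f_j e_i = δ_{ij}(K_i − K_i^{−1})/(q − q^{−1}) with K_i := q^{ε_i}(q^{ε_{i+1}})^{−1}; e_i² e_j − (q+q^{−1}) e_i e_j e_i + e_j e_i² = 0 and f_i² f_j − (q+q^{−1}) f_i f_j f_i + f_j f_i² = 0 for |i−j| = 1; e_i e_j = e_j e_i and f_i f_j = f_j f_i for |i−j| > 1. -/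

import Mathlib

/- Common setup: relations between boxes of Gelfand–Tsetlin tableaux,
admissible sets of relations, tableaux satisfying relations, and the
Gelfand–Tsetlin operators on the space with basis `ℬ_𝒞(T(L))`. -/

noncomputable section

namespace GT

/-- A relation `src ≥ tgt` (`strict = false`) or `src > tgt` (`strict = true`)
between two boxes of a Gelfand–Tsetlin tableau. -/
structure GTRel where
  src : ℕ × ℕ
  tgt : ℕ × ℕ
  strict : Bool

/-- The set ℛ = ℛ^≥ ∪ ℛ^> ∪ ℛ⁰ of relations. -/
def RelSet (n : ℕ) : Set GTRel :=
  {r | (∃ i j j' : ℕ, 1 ≤ j ∧ j ≤ i ∧ i ≤ n ∧ 1 ≤ j' ∧ j' ≤ i - 1 ∧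
          r = ⟨(i, j), (i - 1, j'), false⟩) ∨
       (∃ i j j' : ℕ, 1 ≤ j ∧ j ≤ i ∧ i ≤ n ∧ 1 ≤ j' ∧ j' ≤ i - 1 ∧
          r = ⟨(i - 1, j'), (i, j), true⟩) ∨
       (∃ i j : ℕ, 1 ≤ i ∧ i ≤ n ∧ 1 ≤ j ∧ j ≤ n ∧ i ≠ j ∧
          r = ⟨(n, i), (n, j), false⟩)}

/-- The set 𝔙(𝒞) of vertices occurring in relations of `C`. -/
def vertexSet (C : Set GTRel) : Set (ℕ × ℕ) :=
  {v | ∃ r ∈ C, r.src = v ∨ r.tgt = v}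

/-- Two sets of relations are disconnected if their vertex sets are disjoint. -/
def Disconnected (C₁ C₂ : Set GTRel) : Prop :=
  vertexSet C₁ ∩ vertexSet C₂ = ∅

/-- A nonempty set of relations is indecomposable if it is not the union of two
nonempty disconnected subsets. -/
def Indecomposable (C : Set GTRel) : Prop :=
  C.Nonempty ∧ ∀ C₁ C₂ : Set GTRel, C₁.Nonempty → C₂.Nonempty →
    Disconnected C₁ C₂ → C ≠ C₁ ∪ C₂

/-- `D` is an indecomposable component of `C`. -/
def IsComponent (C D : Set GTRel) : Prop :=
  D ⊆ C ∧ Indecomposable D ∧ Disconnected D (C \ D)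

/-- One step along a relation of `C`. -/
def stepRel (C : Set GTRel) (a b : ℕ × ℕ) : Prop :=
  ∃ r ∈ C, r.src = a ∧ r.tgt = b

/-- One step along a strict relation of `C`. -/
def strictStepRel (C : Set GTRel) (a b : ℕ × ℕ) : Prop :=
  ∃ r ∈ C, r.src = a ∧ r.tgt = b ∧ r.strict = true

/-- `a ⪰_𝒞 b` : there is a (nonempty) chain of relations of `C` from `a` to `b`. -/
def Succeq (C : Set GTRel) : ℕ × ℕ → ℕ × ℕ → Prop :=
  Relation.TransGen (stepRel C)

/-- `a ≻_𝒞 b` : there is a chain of relations of `C` from `a` to `b` in which at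
least one relation is strict. -/
def Succ (C : Set GTRel) (a b : ℕ × ℕ) : Prop :=
  ∃ c d, Relation.ReflTransGen (stepRel C) a c ∧ strictStepRel C c d ∧
    Relation.ReflTransGen (stepRel C) d b

/-- An indecomposable set of relations is admissible. -/
def AdmissibleIndec (n : ℕ) (C : Set GTRel) : Prop :=
  Indecomposable C ∧
  (∀ k i j : ℕ, Succ C (k, i) (k, j) → i < j) ∧
  (∀ i j : ℕ, Succeq C (n, i) (n, j) → i < j) ∧
  (¬ ∃ k i j s t : ℕ, i < j ∧ s < t ∧
      (⟨(k, i), (k - 1, t), false⟩ : GTRel) ∈ C ∧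
      (⟨(k - 1, s), (k, j), true⟩ : GTRel) ∈ C) ∧
  (∀ k i j : ℕ, 1 ≤ k → k ≤ n - 1 →
      (k, i) ∈ vertexSet C → (k, j) ∈ vertexSet C →
      ∃ s t : ℕ, s < t ∧
        (((⟨(k, i), (k + 1, s), true⟩ : GTRel) ∈ C ∧
          (⟨(k + 1, s), (k, j), false⟩ : GTRel) ∈ C ∧
          (⟨(k, i), (k - 1, t), false⟩ : GTRel) ∈ C ∧
          (⟨(k - 1, t), (k, j), true⟩ : GTRel) ∈ C) ∨
         ((⟨(k, i), (k + 1, s), true⟩ : GTRel) ∈ C ∧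
          (⟨(k + 1, t), (k, j), false⟩ : GTRel) ∈ C)))

/-- An arbitrary set of relations is admissible iff all of its indecomposable
components are admissible. -/
def Admissible (n : ℕ) (C : Set GTRel) : Prop :=
  ∀ D, IsComponent C D → AdmissibleIndec n D

/-- `q^x := e^{t x}` where `t` is a fixed logarithm of `q`. -/
def qpow (t x : ℂ) : ℂ := Complex.exp (t * x)

/-- The quantum number `[x]_q = (q^x - q^{-x})/(q - q⁻¹)`. -/
def qnum (q t x : ℂ) : ℂ := (qpow t x - qpow t (-x)) / (q - q⁻¹)

/-- `1(q) = {x : ℂ | q^x = 1}`. -/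
def oneQ (t : ℂ) : Set ℂ := {x | qpow t x = 1}

/-- `ℤ_{≥0} + ½·1(q)`. -/
def intGeHalf (t : ℂ) : Set ℂ := {x | ∃ m : ℤ, 0 ≤ m ∧ ∃ y ∈ oneQ t, x = m + y / 2}

/-- `ℤ_{>0} + ½·1(q)`. -/
def intGtHalf (t : ℂ) : Set ℂ := {x | ∃ m : ℤ, 0 < m ∧ ∃ y ∈ oneQ t, x = m + y / 2}

/-- `ℤ + ½·1(q)`. -/
def intHalf (t : ℂ) : Set ℂ := {x | ∃ m : ℤ, ∃ y ∈ oneQ t, x = m + y / 2}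

/-- `1 + ½·1(q)`. -/
def onePlusHalf (t : ℂ) : Set ℂ := {x | ∃ y ∈ oneQ t, x = 1 + y / 2}

/-- A tableau `L` satisfies a single relation `r`. -/
def SatisfiesRel (t : ℂ) (L : ℕ × ℕ → ℂ) (r : GTRel) : Prop :=
  L r.src - L r.tgt ∈ (if r.strict then intGtHalf t else intGeHalf t)

/-- `a` and `b` lie in the same indecomposable component of `𝔙(𝒞)`. -/
def SameComponent (C : Set GTRel) (a b : ℕ × ℕ) : Prop :=
  a ∈ vertexSet C ∧ b ∈ vertexSet C ∧
  Relation.ReflTransGen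
    (fun x y => ∃ r ∈ C, (r.src = x ∨ r.tgt = x) ∧ (r.src = y ∨ r.tgt = y)) a b

/-- A tableau `L` satisfies the set of relations `C` (is a `C`-realization). -/
def SatisfiesSet (n : ℕ) (t : ℂ) (C : Set GTRel) (L : ℕ × ℕ → ℂ) : Prop :=
  (∀ r ∈ C, SatisfiesRel t L r) ∧
  (∀ k i j : ℕ, 1 ≤ i → i ≤ k → 1 ≤ j → j ≤ k → k ≤ n → i ≠ j →
    L (k, i) - L (k, j) ∈ intHalf t → SameComponent C (k, i) (k, j))

/-- An integer shift vector supported on rows `1, …, n-1`. -/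
def IsShift (n : ℕ) (z : ℕ × ℕ → ℤ) : Prop :=
  ∀ p : ℕ × ℕ, z p ≠ 0 → 1 ≤ p.2 ∧ p.2 ≤ p.1 ∧ p.1 ≤ n - 1

/-- The shifted tableau `L + z`. -/
def addShift (L : ℕ × ℕ → ℂ) (z : ℕ × ℕ → ℤ) : ℕ × ℕ → ℂ :=
  fun p => L p + z p

/-- `ℬ_𝒞(T(L))` : the integer shifts of `L` (rows `1,…,n-1`) satisfying `C`. -/
def BSet (n : ℕ) (t : ℂ) (C : Set GTRel) (L : ℕ × ℕ → ℂ) : Set (ℕ × ℕ → ℂ) :=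
  {R | (∃ z, IsShift n z ∧ R = addShift L z) ∧ SatisfiesSet n t C R}

/-- The tableau `δ^{kj}`. -/
def deltaT (k j : ℕ) : ℕ × ℕ → ℂ := fun p => if p = (k, j) then 1 else 0

/-- The coefficient `e_{kj}(R)` of `T(R + δ^{kj})` in `e_k T(R)`. -/
def ecoeff (q t : ℂ) (k j : ℕ) (R : ℕ × ℕ → ℂ) : ℂ :=
  -(∏ i ∈ Finset.Icc 1 (k + 1), qnum q t (R (k, j) - R (k + 1, i))) /
    ∏ i ∈ (Finset.Icc 1 k).erase j, qnum q t (R (k, j) - R (k, i))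

/-- The coefficient `f_{kj}(R)` of `T(R - δ^{kj})` in `f_k T(R)`. -/
def fcoeff (q t : ℂ) (k j : ℕ) (R : ℕ × ℕ → ℂ) : ℂ :=
  (∏ i ∈ Finset.Icc 1 (k - 1), qnum q t (R (k, j) - R (k - 1, i))) /
    ∏ i ∈ (Finset.Icc 1 k).erase j, qnum q t (R (k, j) - R (k, i))

open scoped Classical in
/-- The basis vector of `V` attached to a tableau, `0` if the tableau is not in the basis. -/
def tabVec (B : Set (ℕ × ℕ → ℂ)) (x : ℕ × ℕ → ℂ) : ↥B →₀ ℂ :=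
  if h : x ∈ B then Finsupp.single ⟨x, h⟩ 1 else 0

/-- Linear extension of a map defined on basis tableaux. -/
def extendLin {B : Set (ℕ × ℕ → ℂ)} (g : ↥B → (↥B →₀ ℂ)) :
    (↥B →₀ ℂ) →ₗ[ℂ] (↥B →₀ ℂ) :=
  Finsupp.lsum ℂ fun R => (LinearMap.id : ℂ →ₗ[ℂ] ℂ).smulRight (g R)

/-- The Gelfand–Tsetlin operator `e_k`. -/
def eOp (q t : ℂ) (B : Set (ℕ × ℕ → ℂ)) (k : ℕ) : (↥B →₀ ℂ) →ₗ[ℂ] (↥B →₀ ℂ) :=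
  extendLin fun R => ∑ j ∈ Finset.Icc 1 k,
    ecoeff q t k j R.1 • tabVec B (R.1 + deltaT k j)

/-- The Gelfand–Tsetlin operator `f_k`. -/
def fOp (q t : ℂ) (B : Set (ℕ × ℕ → ℂ)) (k : ℕ) : (↥B →₀ ℂ) →ₗ[ℂ] (↥B →₀ ℂ) :=
  extendLin fun R => ∑ j ∈ Finset.Icc 1 k,
    fcoeff q t k j R.1 • tabVec B (R.1 - deltaT k j)

/-- The weight `a_k(R) = Σ_{i=1}^k r_{ki} - Σ_{i=1}^{k-1} r_{k-1,i} + k`. -/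
def aWeight (k : ℕ) (R : ℕ × ℕ → ℂ) : ℂ :=
  (∑ i ∈ Finset.Icc 1 k, R (k, i)) - (∑ i ∈ Finset.Icc 1 (k - 1), R (k - 1, i)) + k

/-- The Gelfand–Tsetlin operator `q^{ε_k}`. -/
def qepsOp (t : ℂ) (B : Set (ℕ × ℕ → ℂ)) (k : ℕ) : (↥B →₀ ℂ) →ₗ[ℂ] (↥B →₀ ℂ) :=
  extendLin fun R => qpow t (aWeight k R.1) • tabVec B R.1

/-- The Gelfand–Tsetlin operator `q^{-ε_k}`, inverse of `q^{ε_k}`. -/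
def qepsInvOp (t : ℂ) (B : Set (ℕ × ℕ → ℂ)) (k : ℕ) : (↥B →₀ ℂ) →ₗ[ℂ] (↥B →₀ ℂ) :=
  extendLin fun R => qpow t (-aWeight k R.1) • tabVec B R.1

/-- All the defining relations of `U_q(gl_n)` hold for the Gelfand–Tsetlin
operators on the space with basis `B`. -/
def UqRelationsHold (n : ℕ) (q t : ℂ) (B : Set (ℕ × ℕ → ℂ)) : Prop :=
  (∀ k, 1 ≤ k → k ≤ n →
     qepsOp t B k ∘ₗ qepsInvOp t B k = LinearMap.id ∧
     qepsInvOp t B k ∘ₗ qepsOp t B k = LinearMap.id) ∧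
  (∀ k l, 1 ≤ k → k ≤ n → 1 ≤ l → l ≤ n →
     qepsOp t B k ∘ₗ qepsOp t B l = qepsOp t B l ∘ₗ qepsOp t B k) ∧
  (∀ k l, 1 ≤ k → k ≤ n → 1 ≤ l → l ≤ n - 1 →
     qepsOp t B k ∘ₗ eOp q t B l ∘ₗ qepsInvOp t B k =
       qpow t ((if k = l then 1 else 0) - (if k = l + 1 then 1 else 0)) • eOp q t B l) ∧
  (∀ k l, 1 ≤ k → k ≤ n → 1 ≤ l → l ≤ n - 1 →
     qepsOp t B k ∘ₗ fOp q t B l ∘ₗ qepsInvOp t B k =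
       qpow t (-((if k = l then 1 else 0) - (if k = l + 1 then 1 else 0))) • fOp q t B l) ∧
  (∀ i j, 1 ≤ i → i ≤ n - 1 → 1 ≤ j → j ≤ n - 1 →
     eOp q t B i ∘ₗ fOp q t B j - fOp q t B j ∘ₗ eOp q t B i =
       if i = j then
         (q - q⁻¹)⁻¹ •
           (qepsOp t B i ∘ₗ qepsInvOp t B (i + 1) -
             qepsInvOp t B i ∘ₗ qepsOp t B (i + 1))
       else 0) ∧
  (∀ i j, 1 ≤ i → i ≤ n - 1 → 1 ≤ j → j ≤ n - 1 → |(i : ℤ) - (j : ℤ)| = 1 →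
     eOp q t B i ∘ₗ eOp q t B i ∘ₗ eOp q t B j -
         (q + q⁻¹) • (eOp q t B i ∘ₗ eOp q t B j ∘ₗ eOp q t B i) +
         eOp q t B j ∘ₗ eOp q t B i ∘ₗ eOp q t B i = 0 ∧
     fOp q t B i ∘ₗ fOp q t B i ∘ₗ fOp q t B j -
         (q + q⁻¹) • (fOp q t B i ∘ₗ fOp q t B j ∘ₗ fOp q t B i) +
         fOp q t B j ∘ₗ fOp q t B i ∘ₗ fOp q t B i = 0) ∧
  (∀ i j, 1 ≤ i → i ≤ n - 1 → 1 ≤ j → j ≤ n - 1 → 1 < |(i : ℤ) - (j : ℤ)| →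
     eOp q t B i ∘ₗ eOp q t B j = eOp q t B j ∘ₗ eOp q t B i ∧
     fOp q t B i ∘ₗ fOp q t B j = fOp q t B j ∘ₗ fOp q t B i)

/-- A set of relations is realizable if for every tableau satisfying it, the
Gelfand–Tsetlin formulas define a `U_q(gl_n)`-module structure. -/
def Realizable (n : ℕ) (q t : ℂ) (C : Set GTRel) : Prop :=
  ∀ L : ℕ × ℕ → ℂ, SatisfiesSet n t C L → UqRelationsHold n q t (BSet n t C L)

/-- `C` implies `C'`. -/
def Implies (C C' : Set GTRel) : Prop :=
  (∀ a b, Succ C' a b → Succ C a b) ∧ (∀ a b, Succeq C' a b → Succeq C a b)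

/-- `C` is a maximal set of relations satisfied by `L`. -/
def MaximalFor (n : ℕ) (t : ℂ) (C : Set GTRel) (L : ℕ × ℕ → ℂ) : Prop :=
  SatisfiesSet n t C L ∧
  ∀ C' ⊆ RelSet n, SatisfiesSet n t C' L → Implies C C'

end GT

namespace GT

open Finset

section Qnum

lemma qnum_neg (q t x : ℂ) : qnum q t (-x) = -qnum q t x := by
  simp only [qnum, neg_neg]
  ring

lemma qnum_ne_zero {q t x : ℂ} (hκ : q - q⁻¹ ≠ 0) (h : qpow t (2 * x) ≠ 1) :
    qnum q t x ≠ 0 := by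
  intro h0
  apply h
  have h1 : qpow t x = qpow t (-x) := by
    simpa [qnum, div_eq_zero_iff, hκ, sub_eq_zero] using h0
  calc qpow t (2 * x) = qpow t x * qpow t x := by
        simp only [qpow, ← Complex.exp_add]; congr 1; ring
    _ = qpow t (-x) * qpow t x := by rw [← h1]
    _ = 1 := by simp [qpow, ← Complex.exp_add]

lemma qnum_one {q t : ℂ} (hq : Complex.exp t = q) (hκ : q - q⁻¹ ≠ 0) : qnum q t 1 = 1 := by
  simp [qnum, qpow, Complex.exp_neg, hq, div_self hκ]

lemma qnum_neg_one {q t : ℂ} (hq : Complex.exp t = q) (hκ : q - q⁻¹ ≠ 0) :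
    qnum q t (-1) = -1 := by
  rw [qnum_neg, qnum_one hq hκ]

lemma qnum_three_term {q t σ : ℂ} (hq : Complex.exp t = q) (hσ : σ = 1 ∨ σ = -1) (z : ℂ) :
    qnum q t (z - σ) - (q + q⁻¹) * qnum q t z + qnum q t (z + σ) = 0 := by
  subst hq
  have h1 := Complex.exp_ne_zero t
  have h2 := Complex.exp_ne_zero (t * z)
  rcases hσ with rfl | rfl <;>
  · simp only [qnum, qpow, mul_sub, mul_add, mul_neg, neg_sub, neg_add_rev, mul_one, neg_neg,
      Complex.exp_sub, Complex.exp_add, Complex.exp_neg]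
    field_simp
    ring

/-- The identity behind the Serre relation in the case where the operator applied twice depends on
the row moved by the other one. -/
lemma qnum_serre_inner {q t σ : ℂ} (hq : Complex.exp t = q) (hσ : σ = 1 ∨ σ = -1) (x w y : ℂ) :
    (qnum q t (x - y - σ) * qnum q t (w - y - σ)
        - (q + q⁻¹) * (qnum q t (x - y) * qnum q t (w - y - σ))
        + qnum q t (x - y) * qnum q t (w - y)) * qnum q t (x - w - σ)
      + (qnum q t (w - y - σ) * qnum q t (x - y - σ)
        - (q + q⁻¹) * (qnum q t (w - y) * qnum q t (x - y - σ))
        + qnum q t (w - y) * qnum q t (x - y)) * qnum q t (x - w + σ) = 0 := by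
  subst hq
  have h1 := Complex.exp_ne_zero t
  have h2 := Complex.exp_ne_zero (t * x)
  have h3 := Complex.exp_ne_zero (t * y)
  have h4 := Complex.exp_ne_zero (t * w)
  rcases hσ with rfl | rfl <;>
  · simp only [qnum, qpow, mul_sub, mul_add, mul_neg, neg_sub, neg_add_rev, mul_one, neg_neg,
      Complex.exp_sub, Complex.exp_add, Complex.exp_neg]
    generalize (Complex.exp t - (Complex.exp t)⁻¹) = κ
    field_simp
    ring

/-- The identity behind the Serre relation in the case where the operator applied once depends on
the row moved by the other one. -/
lemma qnum_serre_outer {q t σ : ℂ} (hq : Complex.exp t = q) (hσ : σ = 1 ∨ σ = -1) (x w y : ℂ) :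
    (qnum q t (y - x) * qnum q t (y - w)
        - (q + q⁻¹) * (qnum q t (y - x - σ) * qnum q t (y - w))
        + qnum q t (y - x - σ) * qnum q t (y - w - σ)) * qnum q t (x - w - σ)
      + (qnum q t (y - x) * qnum q t (y - w)
        - (q + q⁻¹) * (qnum q t (y - x) * qnum q t (y - w - σ))
        + qnum q t (y - x - σ) * qnum q t (y - w - σ)) * qnum q t (x - w + σ) = 0 := by
  subst hq
  have h1 := Complex.exp_ne_zero t
  have h2 := Complex.exp_ne_zero (t * x)
  have h3 := Complex.exp_ne_zero (t * y)
  have h4 := Complex.exp_ne_zero (t * w)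
  rcases hσ with rfl | rfl <;>
  · simp only [qnum, qpow, mul_sub, mul_add, mul_neg, neg_sub, neg_add_rev, mul_one, neg_neg,
      Complex.exp_sub, Complex.exp_add, Complex.exp_neg]
    generalize (Complex.exp t - (Complex.exp t)⁻¹) = κ
    field_simp
    ring

/-- Lagrange interpolation at the nodes `W` of a monic polynomial with roots `C`. -/
lemma sum_prod_sub_div_nodes {ι κ : Type*} [DecidableEq ι] (I : Finset ι) (J : Finset κ)
    (hIJ : #J = #I) (W : ι → ℂ) (C : κ → ℂ) (hW : Set.InjOn W I) (hW0 : ∀ p ∈ I, W p ≠ 0) :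
    ∑ p ∈ I, (∏ r ∈ J, (W p - C r)) / (W p * ∏ p' ∈ I.erase p, (W p - W p'))
      = 1 - (∏ r ∈ J, C r) / ∏ p ∈ I, W p := by
  have hprod : ∏ p ∈ I, W p ≠ 0 := prod_ne_zero_iff.2 hW0
  have hdeg : (Lagrange.nodal J C - Lagrange.nodal I W).degree < #I := by
    have := Polynomial.degree_sub_lt_left (p := Lagrange.nodal J C) (q := Lagrange.nodal I W)
      (by rw [Lagrange.degree_nodal, Lagrange.degree_nodal, hIJ])
      (Lagrange.nodal_monic).ne_zero
      (by rw [(Lagrange.nodal_monic).leadingCoeff, (Lagrange.nodal_monic).leadingCoeff])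
    rwa [Lagrange.degree_nodal, hIJ] at this
  have h := congrArg (Polynomial.eval 0) (Lagrange.eq_interpolate hW hdeg)
  rw [Lagrange.interpolate_apply, Polynomial.eval_finsetSum] at h
  simp only [Polynomial.eval_sub, Lagrange.eval_nodal, zero_sub, Polynomial.eval_mul,
    Polynomial.eval_C, Lagrange.basis, Polynomial.eval_prod, Lagrange.basisDivisor,
    Polynomial.eval_X] at h
  have hterm : ∀ p ∈ I, (∏ r ∈ J, (W p - C r)) / (W p * ∏ p' ∈ I.erase p, (W p - W p'))
      = -((-1) ^ #I * (∏ p ∈ I, W p)⁻¹) *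
        ((∏ r ∈ J, (W p - C r) - ∏ p' ∈ I, (W p - W p')) *
          ∏ p' ∈ I.erase p, (W p - W p')⁻¹ * -W p') := by
    intro p hp
    have h0 : ∏ p' ∈ I, (W p - W p') = 0 := prod_eq_zero hp (sub_self _)
    have h1 : (-1 : ℂ) ^ #I = -(-1) ^ #(I.erase p) := by
      rw [← card_erase_add_one hp, pow_succ]; ring
    have h2 := hW0 p hp
    have h3 : ∏ p' ∈ I.erase p, W p' ≠ 0 :=
      prod_ne_zero_iff.2 fun i hi => hW0 i (mem_of_mem_erase hi)
    have h4 : ((-1 : ℂ) ^ #(I.erase p)) * (-1) ^ #(I.erase p) = 1 := by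
      rw [← mul_pow]; simp
    rw [h0, prod_mul_distrib, prod_neg, prod_inv_distrib, h1, ← mul_prod_erase I W hp, mul_inv,
      div_eq_mul_inv, mul_inv, sub_zero]
    calc _ = (∏ r ∈ J, (W p - C r)) * ((W p)⁻¹ * (∏ p' ∈ I.erase p, (W p - W p'))⁻¹) *
          ((-1) ^ #(I.erase p) * (-1) ^ #(I.erase p)) *
          ((∏ p' ∈ I.erase p, W p')⁻¹ * ∏ p' ∈ I.erase p, W p') := by
            rw [h4, inv_mul_cancel₀ h3]; ring
      _ = _ := by ring
  rw [sum_congr rfl hterm, ← mul_sum, ← h, prod_neg, prod_neg, hIJ]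
  have h4 : ((-1 : ℂ) ^ #I) * (-1) ^ #I = 1 := by rw [← mul_pow]; simp
  calc _ = ((-1) ^ #I * (-1) ^ #I) * ((∏ p ∈ I, W p) * (∏ p ∈ I, W p)⁻¹ -
        (∏ r ∈ J, C r) / ∏ p ∈ I, W p) := by ring
    _ = _ := by rw [h4, mul_inv_cancel₀ hprod, one_mul]

lemma qnum_sub_eq (q t w c : ℂ) :
    qnum q t (w - c) = qpow t (-w) * qpow t (-c) * (q - q⁻¹)⁻¹ *
      (qpow t (2 * w) - qpow t (2 * c)) := by
  have h1 : qpow t (-w) * qpow t (-c) * qpow t (2 * w) = qpow t (w - c) := by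
    simp only [qpow, ← Complex.exp_add]; congr 1; ring
  have h2 : qpow t (-w) * qpow t (-c) * qpow t (2 * c) = qpow t (-(w - c)) := by
    simp only [qpow, ← Complex.exp_add]; congr 1; ring
  rw [qnum, ← h1, ← h2]
  ring

lemma prod_qpow {ι : Type*} (s : Finset ι) (t : ℂ) (f : ι → ℂ) :
    ∏ i ∈ s, qpow t (f i) = qpow t (∑ i ∈ s, f i) := by
  simp only [qpow, mul_sum, Complex.exp_sum]

/-- Partial fraction expansion for quantum numbers. -/
lemma sum_prod_qnum_div {ι κ : Type*} [DecidableEq ι] (I : Finset ι) (J : Finset κ)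
    (hIJ : #J = #I) {q t : ℂ} (hκ : q - q⁻¹ ≠ 0) (w : ι → ℂ) (c : κ → ℂ)
    (hw : ∀ p ∈ I, ∀ p' ∈ I, p ≠ p' → qpow t (2 * (w p - w p')) ≠ 1) :
    ∑ p ∈ I, (∏ r ∈ J, qnum q t (w p - c r)) / ∏ p' ∈ I.erase p, qnum q t (w p - w p')
      = qnum q t (∑ p ∈ I, w p - ∑ r ∈ J, c r) := by
  have hne : ∀ x, qpow t x ≠ 0 := fun x => Complex.exp_ne_zero _
  have hinj : Set.InjOn (fun p => qpow t (2 * w p)) I := by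
    intro p hp p' hp' h
    by_contra hpp
    apply hw p hp p' hp' hpp
    have h' : qpow t (2 * w p) = qpow t (2 * w p') := h
    rw [show qpow t (2 * (w p - w p')) = qpow t (2 * w p) / qpow t (2 * w p') by
      simp only [qpow, ← Complex.exp_sub]; congr 1; ring, h', div_self (hne _)]
  have key := sum_prod_sub_div_nodes I J hIJ (fun p => qpow t (2 * w p))
    (fun r => qpow t (2 * c r)) hinj (fun p _ => hne _)
  have hterm : ∀ p ∈ I, (∏ r ∈ J, qnum q t (w p - c r)) /
        ∏ p' ∈ I.erase p, qnum q t (w p - w p')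
      = qpow t (∑ p ∈ I, w p - ∑ r ∈ J, c r) * (q - q⁻¹)⁻¹ *
        ((∏ r ∈ J, (qpow t (2 * w p) - qpow t (2 * c r))) / (qpow t (2 * w p) *
          ∏ p' ∈ I.erase p, (qpow t (2 * w p) - qpow t (2 * w p')))) := by
    intro p hp
    have hD : ∏ p' ∈ I.erase p, (qpow t (2 * w p) - qpow t (2 * w p')) ≠ 0 :=
      prod_ne_zero_iff.2 fun i hi => sub_ne_zero.2 fun h =>
        (mem_erase.1 hi).1 (hinj (mem_of_mem_erase hi) hp h.symm)
    have hJ : #J = #(I.erase p) + 1 := by rw [hIJ, card_erase_add_one hp]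
    have hexp : qpow t (-w p) * qpow t (∑ r ∈ J, -c r) * qpow t (2 * w p)
        = qpow t (∑ p ∈ I, w p - ∑ r ∈ J, c r) * qpow t (∑ p' ∈ I.erase p, -w p') := by
      rw [← add_sum_erase I w hp]
      simp only [qpow, ← Complex.exp_add, sum_neg_distrib]
      congr 1
      ring
    simp only [qnum_sub_eq, prod_mul_distrib, prod_const, prod_qpow]
    rw [hJ, pow_succ, pow_succ]
    have hκ' := inv_ne_zero hκ
    rw [← mul_div_assoc, div_eq_div_iff
      (mul_ne_zero (mul_ne_zero (mul_ne_zero (pow_ne_zero _ (hne _)) (hne _))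
        (pow_ne_zero _ hκ')) hD) (mul_ne_zero (hne _) hD)]
    linear_combination (qpow t (-w p) ^ #(I.erase p) *
      ((q - q⁻¹)⁻¹ ^ #(I.erase p) * (q - q⁻¹)⁻¹) *
      (∏ r ∈ J, (qpow t (2 * w p) - qpow t (2 * c r))) *
      ∏ p' ∈ I.erase p, (qpow t (2 * w p) - qpow t (2 * w p'))) * hexp
  rw [sum_congr rfl hterm, ← mul_sum, key, prod_qpow, prod_qpow, ← mul_sum, ← mul_sum, qnum]
  have : qpow t (2 * ∑ r ∈ J, c r) / qpow t (2 * ∑ p ∈ I, w p) *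
      qpow t (∑ p ∈ I, w p - ∑ r ∈ J, c r) = qpow t (-(∑ p ∈ I, w p - ∑ r ∈ J, c r)) := by
    simp only [qpow, ← Complex.exp_sub, ← Complex.exp_add]
    congr 1
    ring
  rw [← this]
  ring

/-- The partial fraction expansion behind the relation between `e_k` and `f_k`. -/
lemma sum_qnum_commutator {q t : ℂ} (hq : Complex.exp t = q) (hκ : q - q⁻¹ ≠ 0) {k : ℕ}
    (hk : 1 ≤ k) (x y z : ℕ → ℂ)
    (hx : ∀ a ∈ Icc 1 k, ∀ b ∈ Icc 1 k, a ≠ b → ∀ m : ℤ, qpow t (2 * (x a - x b + m)) ≠ 1) :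
    ∑ j ∈ Icc 1 k,
      ((∏ i ∈ Icc 1 (k + 1), qnum q t (x j - y i)) *
            (∏ i ∈ Icc 1 (k - 1), qnum q t (x j + 1 - z i)) /
          ((∏ i ∈ (Icc 1 k).erase j, qnum q t (x j - x i)) *
            ∏ i ∈ (Icc 1 k).erase j, qnum q t (x j + 1 - x i))
        - (∏ i ∈ Icc 1 (k + 1), qnum q t (x j - 1 - y i)) *
            (∏ i ∈ Icc 1 (k - 1), qnum q t (x j - z i)) /
          ((∏ i ∈ (Icc 1 k).erase j, qnum q t (x j - 1 - x i)) *
            ∏ i ∈ (Icc 1 k).erase j, qnum q t (x j - x i)))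
      = qnum q t (2 * ∑ i ∈ Icc 1 k, x i - ∑ i ∈ Icc 1 (k + 1), y i
          - ∑ i ∈ Icc 1 (k - 1), z i - 1) := by
  have hq2 : qpow t 2 ≠ 1 := by
    intro h
    apply hκ
    have h2 : q * q = 1 := by
      rw [← h, ← hq, qpow, ← Complex.exp_add]
      congr 1
      ring
    rw [sub_eq_zero]
    exact eq_inv_of_mul_eq_one_left h2
  have hqn2 : qpow t (-2) ≠ 1 := by
    intro h
    apply hq2
    rw [show (2 : ℂ) = - -2 by ring]
    simp only [qpow, mul_neg (b := (-2 : ℂ)), Complex.exp_neg] at h ⊢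
    simpa using h
  have key := sum_prod_qnum_div ((Icc 1 k).disjSum (Icc 1 k))
    ((Icc 1 (k + 1)).disjSum (Icc 1 (k - 1))) (by simp; omega) hκ (q := q) (t := t)
    (Sum.elim x fun i => x i - 1) (Sum.elim y fun i => z i - 1) (by
      rintro (a | a) ha (b | b) hb hab
      · simpa using hx a (by simpa using ha) b (by simpa using hb) (by simpa using hab) 0
      · by_cases h : a = b
        · subst h; simpa using hq2
        · convert hx a (by simpa using ha) b (by simpa using hb) h 1 using 3
          simp; ring
      · by_cases h : a = b
        · subst h
          convert hqn2 using 2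
          simp
        · convert hx a (by simpa using ha) b (by simpa using hb) h (-1) using 3
          simp; ring
      · simpa using hx a (by simpa using ha) b (by simpa using hb) (by simpa using hab) 0)
  have hl : ∀ j, ((Icc 1 k).disjSum (Icc 1 k)).erase (Sum.inl j)
      = ((Icc 1 k).erase j).disjSum (Icc 1 k) := by
    intro j; ext (i | i) <;> simp
  have hr : ∀ j, ((Icc 1 k).disjSum (Icc 1 k)).erase (Sum.inr j)
      = (Icc 1 k).disjSum ((Icc 1 k).erase j) := by
    intro j; ext (i | i) <;> simp
  simp only [sum_disjSum, prod_disjSum, hl, hr, Sum.elim_inl, Sum.elim_inr] at key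
  rw [← sum_add_distrib] at key
  convert key using 1
  · refine sum_congr rfl fun j hj => ?_
    rw [← mul_prod_erase (Icc 1 k) (fun i => qnum q t (x j - (x i - 1))) hj,
      ← mul_prod_erase (Icc 1 k) (fun i => qnum q t (x j - 1 - x i)) hj]
    simp only [show ∀ a b : ℂ, a - (b - 1) = a + 1 - b from fun a b => by ring,
      show ∀ a b : ℂ, a - 1 + 1 - b = a - b from fun a b => by ring,
      show ∀ a : ℂ, a + 1 - a = 1 from fun a => by ring,
      show ∀ a : ℂ, a - 1 - a = -1 from fun a => by ring, qnum_one hq hκ, qnum_neg_one hq hκ]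
    rw [one_mul, neg_one_mul, neg_mul, div_neg, sub_eq_add_neg]
  · congr 1
    simp only [sum_sub_distrib, sum_const, Nat.card_Icc, nsmul_eq_mul, mul_one]
    have : ((k + 1 - 1 : ℕ) : ℂ) = ((k - 1 + 1 - 1 : ℕ) : ℂ) + 1 := by
      norm_cast; omega
    rw [this]
    ring

end Qnum

section Operators

lemma extendLin_tabVec {B : Set (ℕ × ℕ → ℂ)} (g : ↥B → (↥B →₀ ℂ)) {R : ℕ × ℕ → ℂ} (hR : R ∈ B) :
    extendLin g (tabVec B R) = g ⟨R, hR⟩ := by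
  simp [extendLin, tabVec, hR]

lemma linearMap_ext_tabVec {B : Set (ℕ × ℕ → ℂ)} {f g : (↥B →₀ ℂ) →ₗ[ℂ] (↥B →₀ ℂ)}
    (h : ∀ R ∈ B, f (tabVec B R) = g (tabVec B R)) : f = g := by
  refine Finsupp.lhom_ext' fun R => LinearMap.ext_ring ?_
  simpa [tabVec] using h R.1 R.2

/-- The operator sending `T(R)` to a combination of the tableaux `T(R + v a)`, `a ∈ S`. -/
def shiftOp (B : Set (ℕ × ℕ → ℂ)) (S : Finset ℕ) (v : ℕ → ℕ × ℕ → ℂ)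
    (c : ℕ → (ℕ × ℕ → ℂ) → ℂ) : (↥B →₀ ℂ) →ₗ[ℂ] (↥B →₀ ℂ) :=
  extendLin fun R => ∑ a ∈ S, c a R.1 • tabVec B (R.1 + v a)

variable {B : Set (ℕ × ℕ → ℂ)} {S S' : Finset ℕ} {v v' : ℕ → ℕ × ℕ → ℂ}
  {c c' : ℕ → (ℕ × ℕ → ℂ) → ℂ}

lemma shiftOp_tabVec {R : ℕ × ℕ → ℂ} (hR : R ∈ B) :
    shiftOp B S v c (tabVec B R) = ∑ a ∈ S, c a R • tabVec B (R + v a) :=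
  extendLin_tabVec _ hR

lemma shiftOp_shiftOp_tabVec (hv' : ∀ R ∈ B, ∀ b ∈ S', R + v' b ∈ B) {R : ℕ × ℕ → ℂ}
    (hR : R ∈ B) :
    shiftOp B S v c (shiftOp B S' v' c' (tabVec B R)) =
      ∑ b ∈ S', ∑ a ∈ S, (c' b R * c a (R + v' b)) • tabVec B (R + v' b + v a) := by
  rw [shiftOp_tabVec hR, map_sum]
  refine sum_congr rfl fun b hb => ?_
  rw [map_smul, shiftOp_tabVec (hv' R hR b hb), smul_sum]
  simp only [smul_smul]

lemma shiftOp_comm (hv : ∀ R ∈ B, ∀ a ∈ S, R + v a ∈ B) (hv' : ∀ R ∈ B, ∀ b ∈ S', R + v' b ∈ B)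
    (h : ∀ R ∈ B, ∀ a ∈ S, ∀ b ∈ S', c' b R * c a (R + v' b) = c a R * c' b (R + v a)) :
    shiftOp B S v c ∘ₗ shiftOp B S' v' c' = shiftOp B S' v' c' ∘ₗ shiftOp B S v c := by
  refine linearMap_ext_tabVec fun R hR => ?_
  rw [LinearMap.comp_apply, LinearMap.comp_apply, shiftOp_shiftOp_tabVec hv' hR,
    shiftOp_shiftOp_tabVec hv hR, sum_comm]
  refine sum_congr rfl fun a ha => sum_congr rfl fun b hb => ?_
  rw [h R hR a ha b hb, add_right_comm]

lemma shiftOp_commutator (hv : ∀ R ∈ B, ∀ a ∈ S, R + v a ∈ B)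
    (hv' : ∀ R ∈ B, ∀ b ∈ S, R + v' b ∈ B) (hvv' : ∀ a, v a + v' a = 0)
    (h : ∀ R ∈ B, ∀ a ∈ S, ∀ b ∈ S, a ≠ b → c' b R * c a (R + v' b) = c a R * c' b (R + v a))
    {R : ℕ × ℕ → ℂ} (hR : R ∈ B) :
    (shiftOp B S v c ∘ₗ shiftOp B S v' c' - shiftOp B S v' c' ∘ₗ shiftOp B S v c) (tabVec B R)
      = (∑ a ∈ S, (c' a R * c a (R + v' a) - c a R * c' a (R + v a))) • tabVec B R := by
  rw [LinearMap.sub_apply, LinearMap.comp_apply, LinearMap.comp_apply,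
    shiftOp_shiftOp_tabVec hv' hR, shiftOp_shiftOp_tabVec hv hR, sum_comm, ← sum_sub_distrib,
    sum_smul]
  refine sum_congr rfl fun a ha => ?_
  rw [← sum_sub_distrib, sum_eq_single_of_mem a ha, add_right_comm, add_assoc R, hvv', add_zero,
    sub_smul]
  intro b hb hba
  rw [h R hR a ha b hb hba.symm, add_right_comm, sub_self]

lemma shiftOp_serre (hv : ∀ R ∈ B, ∀ a ∈ S, R + v a ∈ B) (hv' : ∀ R ∈ B, ∀ b ∈ S', R + v' b ∈ B)
    (κ : ℂ) (W : ℕ → ℕ → ℕ → (ℕ × ℕ → ℂ) → ℂ)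
    (hW : ∀ R ∈ B, ∀ s ∈ S', ∀ a ∈ S, ∀ b ∈ S, W s a b R =
      c' s R * c a (R + v' s) * c b (R + v' s + v a) - κ * (c a R * c' s (R + v a) *
        c b (R + v a + v' s)) + c a R * c b (R + v a) * c' s (R + v a + v b))
    (h : ∀ R ∈ B, ∀ s ∈ S', ∀ a ∈ S, ∀ b ∈ S, W s a b R + W s b a R = 0) :
    shiftOp B S v c ∘ₗ shiftOp B S v c ∘ₗ shiftOp B S' v' c' -
      κ • (shiftOp B S v c ∘ₗ shiftOp B S' v' c' ∘ₗ shiftOp B S v c) +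
      shiftOp B S' v' c' ∘ₗ shiftOp B S v c ∘ₗ shiftOp B S v c = 0 := by
  refine linearMap_ext_tabVec fun R hR => ?_
  have h1 : shiftOp B S v c (shiftOp B S v c (shiftOp B S' v' c' (tabVec B R))) =
      ∑ s ∈ S', ∑ a ∈ S, ∑ b ∈ S, (c' s R * c a (R + v' s) * c b (R + v' s + v a)) •
        tabVec B (R + v' s + v a + v b) := by
    rw [shiftOp_tabVec hR, map_sum, map_sum]
    refine sum_congr rfl fun s hs => ?_
    rw [map_smul, map_smul, shiftOp_shiftOp_tabVec hv (hv' R hR s hs)]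
    simp only [smul_sum, smul_smul, mul_assoc]
  have h2 : shiftOp B S v c (shiftOp B S' v' c' (shiftOp B S v c (tabVec B R))) =
      ∑ s ∈ S', ∑ a ∈ S, ∑ b ∈ S, (c a R * c' s (R + v a) * c b (R + v a + v' s)) •
        tabVec B (R + v' s + v a + v b) := by
    rw [shiftOp_tabVec hR, map_sum, map_sum, sum_comm]
    refine sum_congr rfl fun a ha => ?_
    rw [map_smul, map_smul, shiftOp_shiftOp_tabVec hv' (hv R hR a ha)]
    simp only [smul_sum, smul_smul, mul_assoc, add_right_comm R (v a)]
  have h3 : shiftOp B S' v' c' (shiftOp B S v c (shiftOp B S v c (tabVec B R))) =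
      ∑ s ∈ S', ∑ a ∈ S, ∑ b ∈ S, (c a R * c b (R + v a) * c' s (R + v a + v b)) •
        tabVec B (R + v' s + v a + v b) := by
    rw [shiftOp_tabVec hR, map_sum, map_sum, sum_comm]
    refine sum_congr rfl fun a ha => ?_
    rw [map_smul, map_smul, shiftOp_shiftOp_tabVec hv (hv R hR a ha), sum_comm]
    simp only [smul_sum, smul_smul, mul_assoc]
    refine sum_congr rfl fun s _ => sum_congr rfl fun b _ => ?_
    rw [show R + v a + v b + v' s = R + v' s + v a + v b by abel]
  simp only [LinearMap.add_apply, LinearMap.sub_apply, LinearMap.smul_apply, LinearMap.comp_apply,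
    LinearMap.zero_apply]
  rw [h1, h2, h3]
  simp only [smul_sum, ← sum_sub_distrib, ← sum_add_distrib, smul_smul, ← sub_smul, ← add_smul]
  refine sum_eq_zero fun s hs => ?_
  have h4 : ∑ a ∈ S, ∑ b ∈ S, W s a b R • tabVec B (R + v' s + v a + v b) = 0 := by
    refine self_eq_neg.1 ?_
    conv_lhs => rw [sum_comm]
    simp only [← sum_neg_distrib]
    refine sum_congr rfl fun a ha => sum_congr rfl fun b hb => ?_
    rw [← neg_smul, eq_neg_of_add_eq_zero_left (h R hR s hs b hb a ha), add_right_comm (R + v' s)]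
  rw [← h4]
  exact sum_congr rfl fun a ha => sum_congr rfl fun b hb => by rw [hW R hR s hs a ha b hb]

end Operators

section Coefficients

/-- The common shape of `ecoeff` and `fcoeff`: row `k` is shifted, and the numerator runs over the
boxes `(l, i)`, `i ∈ T`. -/
def gtCoeff (q t ε : ℂ) (k l : ℕ) (T : Finset ℕ) (a : ℕ) (R : ℕ × ℕ → ℂ) : ℂ :=
  ε * (∏ i ∈ T, qnum q t (R (k, a) - R (l, i))) /
    ∏ i ∈ (Icc 1 k).erase a, qnum q t (R (k, a) - R (k, i))

/-- No two entries of row `k` of `R` differ by an element of `ℤ + ½·1(q)`. -/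
def RowGeneric (t : ℂ) (k : ℕ) (R : ℕ × ℕ → ℂ) : Prop :=
  ∀ a ∈ Icc 1 k, ∀ b ∈ Icc 1 k, a ≠ b → ∀ m : ℤ, qpow t (2 * (R (k, a) - R (k, b) + m)) ≠ 1

lemma add_smul_deltaT_self (R : ℕ × ℕ → ℂ) (σ : ℂ) (k a : ℕ) :
    (R + σ • deltaT k a) (k, a) = R (k, a) + σ := by
  simp [deltaT]

lemma add_smul_deltaT_of_ne (R : ℕ × ℕ → ℂ) (σ : ℂ) {k a l b : ℕ} (h : l ≠ k ∨ b ≠ a) :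
    (R + σ • deltaT k a) (l, b) = R (l, b) := by
  have : ¬(l = k ∧ b = a) := by tauto
  simp [deltaT, this]

variable {q t ε ε' σ : ℂ} {k l m a b s : ℕ} {T : Finset ℕ} {R : ℕ × ℕ → ℂ}

lemma gtCoeff_add_of_ne (hmk : k ≠ m) (hml : l ≠ m ∨ s ∉ T) :
    gtCoeff q t ε k l T a (R + σ • deltaT m s) = gtCoeff q t ε k l T a R := by
  have h1 : ∀ i, (R + σ • deltaT m s) (k, i) = R (k, i) := fun i =>
    add_smul_deltaT_of_ne R σ (.inl hmk)
  have h2 : ∀ i ∈ T, (R + σ • deltaT m s) (l, i) = R (l, i) := fun i hi =>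
    add_smul_deltaT_of_ne R σ (hml.imp_right fun h => ne_of_mem_of_not_mem hi h)
  simp only [gtCoeff, h1]
  congr 2
  exact prod_congr rfl fun i hi => by rw [h2 i hi]

lemma gtCoeff_eq_mul (hs : s ∈ T) :
    gtCoeff q t ε k l T a R =
      qnum q t (R (k, a) - R (l, s)) * gtCoeff q t ε k l (T.erase s) a R := by
  rw [gtCoeff, gtCoeff, ← mul_prod_erase T _ hs]
  ring

lemma gtCoeff_add_link (hs : s ∈ T) (hkl : k ≠ l) :
    gtCoeff q t ε k l T a (R + σ • deltaT l s) =
      qnum q t (R (k, a) - R (l, s) - σ) * gtCoeff q t ε k l (T.erase s) a R := by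
  rw [gtCoeff_eq_mul hs, gtCoeff_add_of_ne hkl (.inr (notMem_erase s T)), add_smul_deltaT_self,
    add_smul_deltaT_of_ne R σ (.inl hkl), sub_sub]

lemma gtCoeff_add_self (hlk : l ≠ k) :
    gtCoeff q t ε k l T a (R + σ • deltaT k a) =
      ε * (∏ i ∈ T, qnum q t (R (k, a) + σ - R (l, i))) /
        ∏ i ∈ (Icc 1 k).erase a, qnum q t (R (k, a) + σ - R (k, i)) := by
  rw [gtCoeff, add_smul_deltaT_self]
  congr 1
  · simp only [add_smul_deltaT_of_ne R σ (.inl hlk)]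
  · exact prod_congr rfl fun i hi => by
      rw [add_smul_deltaT_of_ne R σ (.inr (mem_erase.1 hi).1)]

lemma gtCoeff_add_row (hlk : l ≠ k) (hb : b ∈ Icc 1 k) (hab : a ≠ b) :
    gtCoeff q t ε k l T a (R + σ • deltaT k b) =
      ε * (∏ i ∈ T, qnum q t (R (k, a) - R (l, i))) /
        (qnum q t (R (k, a) - R (k, b) - σ) *
          ∏ i ∈ ((Icc 1 k).erase a).erase b, qnum q t (R (k, a) - R (k, i))) := by
  rw [gtCoeff, add_smul_deltaT_of_ne R σ (.inr hab),
    ← mul_prod_erase ((Icc 1 k).erase a) _ (mem_erase.2 ⟨hab.symm, hb⟩), add_smul_deltaT_self,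
    sub_sub]
  congr 1
  · simp only [add_smul_deltaT_of_ne R σ (.inl hlk)]
  · congr 1
    exact prod_congr rfl fun i hi => by
      rw [add_smul_deltaT_of_ne R σ (.inr (mem_erase.1 hi).1)]

lemma gtCoeff_row (hlk : l ≠ k) (hb : b ∈ Icc 1 k) (hab : a ≠ b) :
    gtCoeff q t ε k l T a R =
      ε * (∏ i ∈ T, qnum q t (R (k, a) - R (l, i))) /
        (qnum q t (R (k, a) - R (k, b)) *
          ∏ i ∈ ((Icc 1 k).erase a).erase b, qnum q t (R (k, a) - R (k, i))) := by
  simpa using gtCoeff_add_row (q := q) (t := t) (ε := ε) (σ := 0) (T := T) (R := R) hlk hb hab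

lemma gtCoeff_pair (hlk : l ≠ k) (ha : a ∈ Icc 1 k) (hb : b ∈ Icc 1 k) (hab : a ≠ b) :
    ∃ H : ℂ, gtCoeff q t ε k l T a R * gtCoeff q t ε k l T b (R + σ • deltaT k a) =
        H / qnum q t (R (k, a) - R (k, b) + σ) ∧
      gtCoeff q t ε k l T b R * gtCoeff q t ε k l T a (R + σ • deltaT k b) =
        H / qnum q t (R (k, a) - R (k, b) - σ) := by
  refine ⟨-(ε * (∏ i ∈ T, qnum q t (R (k, a) - R (l, i))) *
    (ε * (∏ i ∈ T, qnum q t (R (k, b) - R (l, i))))) / (qnum q t (R (k, a) - R (k, b)) *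
      (∏ i ∈ ((Icc 1 k).erase a).erase b, qnum q t (R (k, a) - R (k, i))) *
      (∏ i ∈ ((Icc 1 k).erase b).erase a, qnum q t (R (k, b) - R (k, i)))), ?_, ?_⟩
  · rw [gtCoeff_row hlk hb hab, gtCoeff_add_row hlk ha hab.symm,
      show R (k, b) - R (k, a) - σ = -(R (k, a) - R (k, b) + σ) by ring, qnum_neg]
    simp only [div_eq_mul_inv, mul_inv, inv_neg]
    ring
  · rw [gtCoeff_row hlk ha hab.symm, gtCoeff_add_row hlk hb hab,
      show R (k, b) - R (k, a) = -(R (k, a) - R (k, b)) by ring, qnum_neg]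
    simp only [div_eq_mul_inv, mul_inv, inv_neg]
    ring

lemma RowGeneric.qnum_add_ne_zero (hκ : q - q⁻¹ ≠ 0) (hR : RowGeneric t k R)
    (hσ : σ = 1 ∨ σ = -1) (ha : a ∈ Icc 1 k) (hb : b ∈ Icc 1 k) (hab : a ≠ b) :
    qnum q t (R (k, a) - R (k, b) + σ) ≠ 0 := by
  apply qnum_ne_zero hκ
  rcases hσ with rfl | rfl
  · simpa using hR a ha b hb hab 1
  · simpa using hR a ha b hb hab (-1)

lemma RowGeneric.qnum_sub_ne_zero (hκ : q - q⁻¹ ≠ 0) (hR : RowGeneric t k R)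
    (hσ : σ = 1 ∨ σ = -1) (ha : a ∈ Icc 1 k) (hb : b ∈ Icc 1 k) (hab : a ≠ b) :
    qnum q t (R (k, a) - R (k, b) - σ) ≠ 0 := by
  rw [sub_eq_add_neg]
  refine hR.qnum_add_ne_zero hκ ?_ ha hb hab
  rcases hσ with rfl | rfl <;> simp

end Coefficients

section GTOperators

/-- The common shape of `eOp` and `fOp`. -/
def gtOp (q t : ℂ) (B : Set (ℕ × ℕ → ℂ)) (σ ε : ℂ) (k l : ℕ) : (↥B →₀ ℂ) →ₗ[ℂ] (↥B →₀ ℂ) :=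
  shiftOp B (Icc 1 k) (fun a => σ • deltaT k a) (gtCoeff q t ε k l (Icc 1 l))

lemma eOp_eq_gtOp (q t : ℂ) (B : Set (ℕ × ℕ → ℂ)) (k : ℕ) :
    eOp q t B k = gtOp q t B 1 (-1) k (k + 1) := by
  simp only [eOp, gtOp, shiftOp, ecoeff, gtCoeff, one_smul, neg_one_mul]

lemma fOp_eq_gtOp (q t : ℂ) (B : Set (ℕ × ℕ → ℂ)) (k : ℕ) :
    fOp q t B k = gtOp q t B (-1) 1 k (k - 1) := by
  simp only [fOp, gtOp, shiftOp, fcoeff, gtCoeff, one_mul, neg_one_smul, sub_eq_add_neg]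

/-- `B` is stable under shifting the boxes of row `k`. -/
def RowClosed (B : Set (ℕ × ℕ → ℂ)) (k : ℕ) : Prop :=
  ∀ R ∈ B, ∀ a ∈ Icc 1 k, ∀ σ : ℂ, σ = 1 ∨ σ = -1 → R + σ • deltaT k a ∈ B

variable {q t ε ε' σ σ' : ℂ} {B : Set (ℕ × ℕ → ℂ)} {i j l l' : ℕ}

lemma gtOp_comm_of_ne (hi : RowClosed B i) (hj : RowClosed B j) (hσ : σ = 1 ∨ σ = -1)
    (hσ' : σ' = 1 ∨ σ' = -1) (hij : i ≠ j) (hl : l ≠ j) (hl' : l' ≠ i) :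
    gtOp q t B σ ε i l ∘ₗ gtOp q t B σ' ε' j l' = gtOp q t B σ' ε' j l' ∘ₗ gtOp q t B σ ε i l := by
  refine shiftOp_comm (fun R hR a ha => hi R hR a ha σ hσ) (fun R hR a ha => hj R hR a ha σ' hσ')
    fun R hR a ha b hb => ?_
  rw [gtCoeff_add_of_ne hij (.inl hl), gtCoeff_add_of_ne hij.symm (.inl hl'), mul_comm]

lemma gtOp_comm_of_linked (hi : RowClosed B i) (hj : RowClosed B j) (hσ : σ = 1 ∨ σ = -1)
    (hij : i ≠ j) :
    gtOp q t B σ ε i j ∘ₗ gtOp q t B (-σ) ε' j i =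
      gtOp q t B (-σ) ε' j i ∘ₗ gtOp q t B σ ε i j := by
  refine shiftOp_comm (fun R hR a ha => hi R hR a ha σ hσ)
    (fun R hR a ha => hj R hR a ha (-σ) (by rcases hσ with rfl | rfl <;> simp))
    fun R hR a ha b hb => ?_
  rw [gtCoeff_add_link hb hij, gtCoeff_add_link ha hij.symm, gtCoeff_eq_mul ha, gtCoeff_eq_mul hb,
    show R (j, b) - R (i, a) - σ = -(R (i, a) - R (j, b) - -σ) by ring,
    show R (j, b) - R (i, a) = -(R (i, a) - R (j, b)) by ring, qnum_neg, qnum_neg]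
  ring

lemma gtOp_commutator (hi : RowClosed B i) (hσ : σ = 1 ∨ σ = -1) (hl : l ≠ i) (hl' : l' ≠ i)
    {R : ℕ × ℕ → ℂ} (hR : R ∈ B) :
    (gtOp q t B σ ε i l ∘ₗ gtOp q t B (-σ) ε' i l' -
        gtOp q t B (-σ) ε' i l' ∘ₗ gtOp q t B σ ε i l) (tabVec B R) =
      (∑ a ∈ Icc 1 i,
        (gtCoeff q t ε' i l' (Icc 1 l') a R *
            gtCoeff q t ε i l (Icc 1 l) a (R + (-σ) • deltaT i a)
          - gtCoeff q t ε i l (Icc 1 l) a R *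
            gtCoeff q t ε' i l' (Icc 1 l') a (R + σ • deltaT i a))) • tabVec B R := by
  refine shiftOp_commutator (fun R hR a ha => hi R hR a ha σ hσ)
    (fun R hR a ha => hi R hR a ha (-σ) (by rcases hσ with rfl | rfl <;> simp))
    (fun a => by simp) (fun R hR a ha b hb hab => ?_) hR
  rw [gtCoeff_row hl' ha hab.symm, gtCoeff_add_row hl hb hab, gtCoeff_row hl hb hab,
    gtCoeff_add_row hl' ha hab.symm,
    show R (i, b) - R (i, a) - σ = -(R (i, a) - R (i, b) - -σ) by ring,
    show R (i, b) - R (i, a) = -(R (i, a) - R (i, b)) by ring, qnum_neg, qnum_neg]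
  simp only [div_eq_mul_inv, mul_inv, inv_neg]
  ring

lemma gtOp_serre_inner (hq : Complex.exp t = q) (hκ : q - q⁻¹ ≠ 0) (hi : RowClosed B i)
    (hj : RowClosed B j) (hg : ∀ R ∈ B, RowGeneric t i R) (hσ : σ = 1 ∨ σ = -1) (hij : i ≠ j)
    (hl' : l' ≠ i) :
    gtOp q t B σ ε i j ∘ₗ gtOp q t B σ ε i j ∘ₗ gtOp q t B σ ε' j l' -
      (q + q⁻¹) • (gtOp q t B σ ε i j ∘ₗ gtOp q t B σ ε' j l' ∘ₗ gtOp q t B σ ε i j) +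
      gtOp q t B σ ε' j l' ∘ₗ gtOp q t B σ ε i j ∘ₗ gtOp q t B σ ε i j = 0 := by
  refine shiftOp_serre (fun R hR a ha => hi R hR a ha σ hσ) (fun R hR a ha => hj R hR a ha σ hσ)
    (q + q⁻¹) (fun s a b R => gtCoeff q t ε' j l' (Icc 1 l') s R *
      (gtCoeff q t ε i j ((Icc 1 j).erase s) a R *
        gtCoeff q t ε i j ((Icc 1 j).erase s) b (R + σ • deltaT i a)) *
      (qnum q t (R (i, a) - R (j, s) - σ) *
          qnum q t ((R + σ • deltaT i a) (i, b) - R (j, s) - σ)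
        - (q + q⁻¹) * (qnum q t (R (i, a) - R (j, s)) *
          qnum q t ((R + σ • deltaT i a) (i, b) - R (j, s) - σ))
        + qnum q t (R (i, a) - R (j, s)) *
          qnum q t ((R + σ • deltaT i a) (i, b) - R (j, s)))) ?_ ?_
  · intro R hR s hs a ha b hb
    rw [add_right_comm R (σ • deltaT j s)]
    simp only [gtCoeff_add_link hs hij, gtCoeff_eq_mul hs, gtCoeff_add_of_ne hij.symm (.inl hl'),
      add_smul_deltaT_of_ne R σ (.inl hij.symm)]
    ring
  · intro R hR s hs a ha b hb
    by_cases hab : a = b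
    · subst hab
      rw [add_smul_deltaT_self, show R (i, a) + σ - R (j, s) - σ = R (i, a) - R (j, s) by ring,
        show R (i, a) + σ - R (j, s) = R (i, a) - R (j, s) + σ by ring]
      linear_combination 2 * gtCoeff q t ε' j l' (Icc 1 l') s R *
        (gtCoeff q t ε i j ((Icc 1 j).erase s) a R *
          gtCoeff q t ε i j ((Icc 1 j).erase s) a (R + σ • deltaT i a)) *
        qnum q t (R (i, a) - R (j, s)) * qnum_three_term hq hσ (R (i, a) - R (j, s))
    · rw [add_smul_deltaT_of_ne R σ (.inr hab), add_smul_deltaT_of_ne R σ (.inr (Ne.symm hab))]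
      obtain ⟨H, h1, h2⟩ := gtCoeff_pair (q := q) (t := t) (ε := ε) (σ := σ) (R := R)
        (T := (Icc 1 j).erase s) hij.symm ha hb hab
      rw [h1, h2]
      have hp := (hg R hR).qnum_add_ne_zero (q := q) hκ hσ ha hb hab
      have hm := (hg R hR).qnum_sub_ne_zero (q := q) hκ hσ ha hb hab
      have key := qnum_serre_inner hq hσ (R (i, a)) (R (i, b)) (R (j, s))
      rw [mul_div_assoc', mul_div_assoc', div_mul_eq_mul_div, div_mul_eq_mul_div,
        div_add_div _ _ hp hm, div_eq_zero_iff]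
      left
      linear_combination gtCoeff q t ε' j l' (Icc 1 l') s R * H * key

lemma gtOp_serre_outer (hq : Complex.exp t = q) (hκ : q - q⁻¹ ≠ 0) (hi : RowClosed B i)
    (hj : RowClosed B j) (hg : ∀ R ∈ B, RowGeneric t i R) (hσ : σ = 1 ∨ σ = -1) (hij : i ≠ j)
    (hl : l ≠ i) (hlj : l ≠ j) :
    gtOp q t B σ ε i l ∘ₗ gtOp q t B σ ε i l ∘ₗ gtOp q t B σ ε' j i -
      (q + q⁻¹) • (gtOp q t B σ ε i l ∘ₗ gtOp q t B σ ε' j i ∘ₗ gtOp q t B σ ε i l) +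
      gtOp q t B σ ε' j i ∘ₗ gtOp q t B σ ε i l ∘ₗ gtOp q t B σ ε i l = 0 := by
  refine shiftOp_serre (fun R hR a ha => hi R hR a ha σ hσ) (fun R hR a ha => hj R hR a ha σ hσ)
    (q + q⁻¹) (fun s a b R => gtCoeff q t ε i l (Icc 1 l) a R *
        gtCoeff q t ε i l (Icc 1 l) b (R + σ • deltaT i a) *
      (gtCoeff q t ε' j i (Icc 1 i) s R
        - (q + q⁻¹) * gtCoeff q t ε' j i (Icc 1 i) s (R + σ • deltaT i a)
        + gtCoeff q t ε' j i (Icc 1 i) s (R + σ • deltaT i a + σ • deltaT i b))) ?_ ?_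
  · intro R hR s hs a ha b hb
    rw [add_right_comm R (σ • deltaT j s)]
    simp only [gtCoeff_add_of_ne hij (.inl hlj)]
    ring
  · intro R hR s hs a ha b hb
    by_cases hab : a = b
    · subst hab
      rw [gtCoeff_add_link ha hij.symm, gtCoeff_add_link ha hij.symm,
        gtCoeff_add_of_ne hij.symm (.inr (notMem_erase a _)), gtCoeff_eq_mul (R := R) ha,
        add_smul_deltaT_self, add_smul_deltaT_of_ne R σ (.inl hij.symm)]
      have key := qnum_three_term hq hσ (R (j, s) - R (i, a) - σ)
      rw [sub_add_cancel] at key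
      rw [show R (j, s) - (R (i, a) + σ) - σ = R (j, s) - R (i, a) - σ - σ by ring]
      linear_combination 2 * gtCoeff q t ε i l (Icc 1 l) a R *
        gtCoeff q t ε i l (Icc 1 l) a (R + σ • deltaT i a) *
        gtCoeff q t ε' j i ((Icc 1 i).erase a) s R * key
    · have hb' : b ∈ (Icc 1 i).erase a := mem_erase.2 ⟨Ne.symm hab, hb⟩
      have ha' : a ∈ (Icc 1 i).erase b := mem_erase.2 ⟨hab, ha⟩
      obtain ⟨H, h1, h2⟩ := gtCoeff_pair (q := q) (t := t) (ε := ε) (σ := σ) (R := R)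
        (T := Icc 1 l) hl ha hb hab
      rw [h1, h2, add_right_comm R (σ • deltaT i b)]
      have hp := (hg R hR).qnum_add_ne_zero (q := q) hκ hσ ha hb hab
      have hm := (hg R hR).qnum_sub_ne_zero (q := q) hκ hσ ha hb hab
      have key := qnum_serre_outer hq hσ (R (i, a)) (R (i, b)) (R (j, s))
      have e0 : gtCoeff q t ε' j i (Icc 1 i) s R = qnum q t (R (j, s) - R (i, a)) *
          (qnum q t (R (j, s) - R (i, b)) *
            gtCoeff q t ε' j i (((Icc 1 i).erase a).erase b) s R) := by
        rw [gtCoeff_eq_mul ha, gtCoeff_eq_mul hb']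
      have ea : gtCoeff q t ε' j i (Icc 1 i) s (R + σ • deltaT i a) =
          qnum q t (R (j, s) - R (i, a) - σ) * (qnum q t (R (j, s) - R (i, b)) *
            gtCoeff q t ε' j i (((Icc 1 i).erase a).erase b) s R) := by
        rw [gtCoeff_add_link ha hij.symm, gtCoeff_eq_mul hb']
      have eb : gtCoeff q t ε' j i (Icc 1 i) s (R + σ • deltaT i b) =
          qnum q t (R (j, s) - R (i, b) - σ) * (qnum q t (R (j, s) - R (i, a)) *
            gtCoeff q t ε' j i (((Icc 1 i).erase a).erase b) s R) := by
        rw [gtCoeff_add_link hb hij.symm, gtCoeff_eq_mul ha', erase_right_comm]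
      have eab : gtCoeff q t ε' j i (Icc 1 i) s (R + σ • deltaT i a + σ • deltaT i b) =
          qnum q t (R (j, s) - R (i, b) - σ) * (qnum q t (R (j, s) - R (i, a) - σ) *
            gtCoeff q t ε' j i (((Icc 1 i).erase a).erase b) s R) := by
        rw [gtCoeff_add_link hb hij.symm, gtCoeff_add_link ha' hij.symm,
          add_smul_deltaT_of_ne R σ (.inl hij.symm), add_smul_deltaT_of_ne R σ (.inr (Ne.symm hab)),
          erase_right_comm]
      rw [e0, ea, eb, eab, div_mul_eq_mul_div, div_mul_eq_mul_div, div_add_div _ _ hp hm,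
        div_eq_zero_iff]
      left
      linear_combination gtCoeff q t ε' j i (((Icc 1 i).erase a).erase b) s R * H * key

end GTOperators

section Weights

variable {q t ε σ : ℂ} {B : Set (ℕ × ℕ → ℂ)} {k l m : ℕ} {R : ℕ × ℕ → ℂ}

lemma qpow_mul_qpow (t x y : ℂ) : qpow t x * qpow t y = qpow t (x + y) := by
  rw [qpow, qpow, qpow, ← Complex.exp_add, mul_add]

lemma qpow_zero (t : ℂ) : qpow t 0 = 1 := by simp [qpow]

lemma qepsOp_tabVec (hR : R ∈ B) :
    qepsOp t B k (tabVec B R) = qpow t (aWeight k R) • tabVec B R :=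
  extendLin_tabVec _ hR

lemma qepsInvOp_tabVec (hR : R ∈ B) :
    qepsInvOp t B k (tabVec B R) = qpow t (-aWeight k R) • tabVec B R :=
  extendLin_tabVec _ hR

lemma sum_add_smul_deltaT (R : ℕ × ℕ → ℂ) (σ : ℂ) {a : ℕ} (ha : a ∈ Icc 1 l) (k : ℕ) :
    ∑ i ∈ Icc 1 k, (R + σ • deltaT l a) (k, i) =
      ∑ i ∈ Icc 1 k, R (k, i) + if k = l then σ else 0 := by
  by_cases h : k = l
  · subst h
    simp [deltaT, sum_add_distrib, (mem_Icc.1 ha).1, (mem_Icc.1 ha).2]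
  · simp [deltaT, h]

lemma aWeight_add_smul_deltaT (hk : 1 ≤ k) {a : ℕ} (ha : a ∈ Icc 1 l) :
    aWeight k (R + σ • deltaT l a) =
      aWeight k R + σ * ((if k = l then 1 else 0) - (if k = l + 1 then 1 else 0)) := by
  rw [aWeight, aWeight, sum_add_smul_deltaT R σ ha, sum_add_smul_deltaT R σ ha,
    if_congr (show k - 1 = l ↔ k = l + 1 by omega) rfl rfl]
  split_ifs <;> ring

lemma qepsOp_comp_qepsInvOp : qepsOp t B k ∘ₗ qepsInvOp t B k = LinearMap.id :=
  linearMap_ext_tabVec fun R hR => by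
    simp [qepsOp_tabVec hR, qepsInvOp_tabVec hR, smul_smul, qpow_mul_qpow, qpow_zero]

lemma qepsInvOp_comp_qepsOp : qepsInvOp t B k ∘ₗ qepsOp t B k = LinearMap.id :=
  linearMap_ext_tabVec fun R hR => by
    simp [qepsOp_tabVec hR, qepsInvOp_tabVec hR, smul_smul, qpow_mul_qpow, qpow_zero]

lemma qepsOp_comm : qepsOp t B k ∘ₗ qepsOp t B l = qepsOp t B l ∘ₗ qepsOp t B k :=
  linearMap_ext_tabVec fun R hR => by
    simp [qepsOp_tabVec hR, smul_smul, mul_comm]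

lemma qepsOp_conj_gtOp (hl : RowClosed B l) (hσ : σ = 1 ∨ σ = -1) (hk : 1 ≤ k) :
    qepsOp t B k ∘ₗ gtOp q t B σ ε l m ∘ₗ qepsInvOp t B k =
      qpow t (σ * ((if k = l then 1 else 0) - (if k = l + 1 then 1 else 0))) •
        gtOp q t B σ ε l m := by
  refine linearMap_ext_tabVec fun R hR => ?_
  rw [LinearMap.comp_apply, LinearMap.comp_apply, qepsInvOp_tabVec hR, map_smul, map_smul,
    LinearMap.smul_apply, gtOp, shiftOp_tabVec hR, map_sum, smul_sum, smul_sum]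
  refine sum_congr rfl fun a ha => ?_
  rw [map_smul, qepsOp_tabVec (hl R hR a ha σ hσ), aWeight_add_smul_deltaT hk ha, smul_smul,
    smul_smul, smul_smul, ← qpow_mul_qpow]
  have h := qpow_mul_qpow t (-aWeight k R) (aWeight k R)
  rw [neg_add_cancel, qpow_zero] at h
  congr 1
  linear_combination (gtCoeff q t ε l m (Icc 1 m) a R *
    qpow t (σ * ((if k = l then 1 else 0) - (if k = l + 1 then 1 else 0)))) * h

lemma eOp_fOp_commutator (hq : Complex.exp t = q) (hκ : q - q⁻¹ ≠ 0) (hk : 1 ≤ k)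
    (hc : RowClosed B k) (hg : ∀ R ∈ B, RowGeneric t k R) :
    eOp q t B k ∘ₗ fOp q t B k - fOp q t B k ∘ₗ eOp q t B k =
      (q - q⁻¹)⁻¹ • (qepsOp t B k ∘ₗ qepsInvOp t B (k + 1) -
        qepsInvOp t B k ∘ₗ qepsOp t B (k + 1)) := by
  refine linearMap_ext_tabVec fun R hR => ?_
  rw [eOp_eq_gtOp, fOp_eq_gtOp, gtOp_commutator hc (.inl rfl) (by omega) (by omega) hR]
  simp only [LinearMap.smul_apply, LinearMap.sub_apply, LinearMap.comp_apply,
    qepsOp_tabVec hR, qepsInvOp_tabVec hR, map_smul, smul_smul, ← sub_smul, qpow_mul_qpow]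
  congr 1
  have key := sum_qnum_commutator hq hκ hk (fun i => R (k, i)) (fun i => R (k + 1, i))
    (fun i => R (k - 1, i)) (hg R hR)
  calc _ = _ := sum_congr rfl fun a ha => ?_
    _ = _ := key
    _ = _ := ?_
  · rw [gtCoeff_add_self (by omega), gtCoeff_add_self (by omega), gtCoeff, gtCoeff]
    simp only [← sub_eq_add_neg, div_eq_mul_inv, mul_inv]
    ring
  · have h : aWeight k R - aWeight (k + 1) R = 2 * ∑ i ∈ Icc 1 k, R (k, i)
        - ∑ i ∈ Icc 1 (k + 1), R (k + 1, i) - ∑ i ∈ Icc 1 (k - 1), R (k - 1, i) - 1 := by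
      simp only [aWeight, add_tsub_cancel_right]
      push_cast
      ring
    rw [← h, qnum, div_eq_inv_mul]
    congr 3 <;> ring

end Weights

section Basis

variable {n k : ℕ} {t : ℂ} {L : ℕ × ℕ → ℂ}

lemma add_int_mem_intHalf {x : ℂ} {m : ℤ} : x + m ∈ intHalf t ↔ x ∈ intHalf t := by
  constructor
  · rintro ⟨p, y, hy, h⟩
    exact ⟨p - m, y, hy, by push_cast; linear_combination h⟩
  · rintro ⟨p, y, hy, h⟩
    exact ⟨p + m, y, hy, by push_cast; linear_combination h⟩

lemma not_sameComponent_empty (a b : ℕ × ℕ) : ¬SameComponent ∅ a b := by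
  rintro ⟨⟨r, hr, -⟩, -⟩
  exact hr

lemma rowGeneric_of_mem_BSet (hk : k ≤ n) : ∀ R ∈ BSet n t ∅ L, RowGeneric t k R := by
  intro R hR a ha b hb hab m h
  rw [mem_Icc] at ha hb
  refine not_sameComponent_empty _ _ (hR.2.2 k a b ha.1 ha.2 hb.1 hb.2 hk hab ?_)
  exact ⟨-m, _, h, by push_cast; ring⟩

lemma rowClosed_BSet (hk : k ≤ n - 1) : RowClosed (BSet n t ∅ L) k := by
  rintro R ⟨⟨z, hz, rfl⟩, -, hR⟩ a ha σ hσ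
  rw [mem_Icc] at ha
  obtain ⟨τ, rfl⟩ : ∃ τ : ℤ, σ = τ := by
    rcases hσ with rfl | rfl
    exacts [⟨1, by simp⟩, ⟨-1, by simp⟩]
  have happ : ∀ p, (addShift L z + (τ : ℂ) • deltaT k a) p =
      addShift L z p + ((if p = (k, a) then τ else 0 : ℤ) : ℂ) := by
    intro p
    by_cases h : p = (k, a) <;> simp [deltaT, h]
  refine ⟨⟨fun p => z p + if p = (k, a) then τ else 0, ?_, ?_⟩, fun r hr => hr.elim, ?_⟩
  · intro p hp
    by_cases h : p = (k, a)
    · subst h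
      exact ⟨ha.1, ha.2, hk⟩
    · exact hz p (by simpa [h] using hp)
  · funext p
    rw [happ, addShift, addShift]
    push_cast
    ring
  · intro k' i j hi hik hj hjk hkn hij h
    refine (not_sameComponent_empty _ _ (hR k' i j hi hik hj hjk hkn hij ?_)).elim
    rw [happ, happ, add_sub_add_comm, ← Int.cast_sub] at h
    exact add_int_mem_intHalf.1 h

end Basis

lemma sub_inv_ne_zero_of_not_root {q : ℂ} (h0 : q ≠ 0) (hroot : ∀ m : ℕ, 0 < m → q ^ m ≠ 1) :
    q - q⁻¹ ≠ 0 := by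
  intro h
  apply hroot 2 two_pos
  rw [pow_two]
  nth_rewrite 2 [sub_eq_zero.1 h]
  exact mul_inv_cancel₀ h0

end GT

open GT in
/-- for a generic tableau `T(L)`, the Gelfand–Tsetlin operators on
`V_∅(T(L))` satisfy all the defining relations of `U_q(gl_n)`. -/
theorem generic_module
    (n : ℕ) (hn : 2 ≤ n) (q t : ℂ) (hq : Complex.exp t = q)
    (hroot : ∀ m : ℕ, 0 < m → q ^ m ≠ 1)
    (L : ℕ × ℕ → ℂ)
    (hgen : ∀ k i j : ℕ, 1 ≤ i → i < j → j ≤ k → k ≤ n →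
      L (k, i) - L (k, j) ∉ intHalf t) :
    UqRelationsHold n q t (BSet n t ∅ L) := by
  have hκ : q - q⁻¹ ≠ 0 :=
    sub_inv_ne_zero_of_not_root (hq ▸ Complex.exp_ne_zero t) hroot
  have hc : ∀ {k}, k ≤ n - 1 → RowClosed (BSet n t ∅ L) k := rowClosed_BSet
  have hg : ∀ {k}, k ≤ n - 1 → ∀ R ∈ BSet n t ∅ L, RowGeneric t k R := fun hk =>
    rowGeneric_of_mem_BSet (by omega)
  have h1 : (1 : ℂ) = 1 ∨ (1 : ℂ) = -1 := .inl rfl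
  have h2 : (-1 : ℂ) = 1 ∨ (-1 : ℂ) = -1 := .inr rfl
  refine ⟨fun k _ _ => ⟨qepsOp_comp_qepsInvOp, qepsInvOp_comp_qepsOp⟩,
    fun k l _ _ _ _ => qepsOp_comm, fun k l hk _ _ hl => ?_, fun k l hk _ _ hl => ?_,
    fun i j hi hin hj hjn => ?_, fun i j hi hin hj hjn hij => ?_, fun i j hi hin hj hjn hij => ?_⟩
  · rw [eOp_eq_gtOp, qepsOp_conj_gtOp (hc hl) h1 hk, one_mul]
  · rw [fOp_eq_gtOp, qepsOp_conj_gtOp (hc hl) h2 hk, neg_one_mul]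
  · split_ifs with hij
    · subst hij
      exact eOp_fOp_commutator hq hκ hi (hc hin) (hg hin)
    · rw [eOp_eq_gtOp, fOp_eq_gtOp]
      have hcomm : gtOp q t (BSet n t ∅ L) 1 (-1) i (i + 1) ∘ₗ
            gtOp q t (BSet n t ∅ L) (-1) 1 j (j - 1) =
          gtOp q t (BSet n t ∅ L) (-1) 1 j (j - 1) ∘ₗ
            gtOp q t (BSet n t ∅ L) 1 (-1) i (i + 1) := by
        by_cases h : j = i + 1
        · subst h
          exact gtOp_comm_of_linked (hc hin) (hc hjn) h1 hij
        · exact gtOp_comm_of_ne (hc hin) (hc hjn) h1 h2 hij (by omega) (by omega)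
      rw [hcomm]
      exact LinearMap.ext fun x => sub_self _
  · simp only [eOp_eq_gtOp, fOp_eq_gtOp]
    rcases (abs_eq zero_le_one).1 hij with h | h
    · obtain rfl : i = j + 1 := by omega
      exact ⟨gtOp_serre_outer hq hκ (hc hin) (hc hjn) (hg hin) h1 (by omega) (by omega) (by omega),
        gtOp_serre_inner hq hκ (hc hin) (hc hjn) (hg hin) h2 (by omega) (by omega)⟩
    · obtain rfl : j = i + 1 := by omega
      exact ⟨gtOp_serre_inner hq hκ (hc hin) (hc hjn) (hg hin) h1 (by omega) (by omega),
        gtOp_serre_outer hq hκ (hc hin) (hc hjn) (hg hin) h2 (by omega) (by omega) (by omega)⟩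
  · simp only [eOp_eq_gtOp, fOp_eq_gtOp]
    rw [lt_abs] at hij
    exact ⟨gtOp_comm_of_ne (hc hin) (hc hjn) h1 h1 (by omega) (by omega) (by omega),
      gtOp_comm_of_ne (hc hin) (hc hjn) h2 h2 (by omega) (by omega) (by omega)⟩
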